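/- Consider server iterates (x_i, y_i) and server momenta (m^y_i) of Fed-MiMA type: x_{i+1} = x_i − μ_x m^x_i/‖m^x_i‖ and y_{i+1} = y_i + μ_y m^y_i/‖m^y_i‖ with m^x_i, m^y_i nonzero, under L_f-smoothness of J and the ν-PL assumption, with μ_x ≤ μ_y/(6κ). Let Δ₀ := P(x₀) − J(x₀,y₀). Then for every T ≥ 1: (1/T)·Σ_{i=0}^{T−1} dist(y_i, Y*(x_i)) ≤ 2·dist(y₀, Y*(x₀))/T + 6Δ₀/(ν·μ_y·T) + (16/(ν·T))·Σ_{i=0}^{T−1} ‖∇_y J(x_i,y_i) − m^y_i‖ + (3κ·μ_y + μ_x/2 + 17κ·μ_x + 2μ_y). -/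

import Mathlib

open scoped RealInnerProductSpace BigOperators

/-- The envelope function `P(x) = sup_y J(x,y)`. -/
noncomputable def Penv {α β : Type*} (J : α → β → ℝ) (x : α) : ℝ := ⨆ y, J x y

/-- The set of maximizers `Y*(x) = argmax_y J(x,y)`. -/
def argmaxY {α β : Type*} (J : α → β → ℝ) (x : α) : Set β := {y | ∀ y', J x y' ≤ J x y}

section PolyakLojasiewicz

variable {E : Type*} [NormedAddCommGroup E] [InnerProductSpace ℝ E]

theorem descent_lower_bound {f : E → ℝ} {g : E → E} {L : ℝ}
    (hf : ∀ z, HasFDerivAt f (innerSL ℝ (g z)) z)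
    (hg : ∀ z w, ‖g z - g w‖ ≤ L * ‖z - w‖) (z h : E) :
    f z + ⟪g z, h⟫ - L / 2 * ‖h‖ ^ 2 ≤ f (z + h) := by
  have hd : ∀ t : ℝ, HasDerivAt
      (fun t : ℝ => f (z + t • h) - t * ⟪g z, h⟫ + L / 2 * ‖h‖ ^ 2 * t ^ 2)
      (⟪g (z + t • h), h⟫ - ⟪g z, h⟫ + L * ‖h‖ ^ 2 * t) t := by
    intro t
    have h1 : HasDerivAt (fun t : ℝ => z + t • h) h t := by
      simpa using ((hasDerivAt_id t).smul_const h).const_add z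
    have h2 := (hf (z + t • h)).comp_hasDerivAt t h1
    have h3 := (h2.sub ((hasDerivAt_id t).mul_const ⟪g z, h⟫)).add
      ((hasDerivAt_pow 2 t).const_mul (L / 2 * ‖h‖ ^ 2))
    refine h3.congr_deriv ?_
    simp only [innerSL_apply_apply]
    push_cast
    ring
  have hmono : MonotoneOn
      (fun t : ℝ => f (z + t • h) - t * ⟪g z, h⟫ + L / 2 * ‖h‖ ^ 2 * t ^ 2) (Set.Ici 0) := by
    refine monotoneOn_of_hasDerivWithinAt_nonneg (convex_Ici 0)
      (fun t _ => (hd t).continuousAt.continuousWithinAt)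
      (fun t _ => (hd t).hasDerivWithinAt) ?_
    intro t ht
    rw [interior_Ici] at ht
    have h1 := neg_le_of_abs_le (abs_real_inner_le_norm (g (z + t • h) - g z) h)
    have h2 := hg (z + t • h) z
    rw [add_sub_cancel_left, norm_smul, Real.norm_of_nonneg (le_of_lt ht)] at h2
    have h3 := mul_le_mul_of_nonneg_right h2 (norm_nonneg h)
    rw [inner_sub_left] at h1
    nlinarith
  have := hmono (Set.mem_Ici.2 le_rfl) (Set.mem_Ici.2 zero_le_one) zero_le_one
  simp only [zero_smul, add_zero, one_smul] at this
  nlinarith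

theorem norm_sub_two_mul_le_inner_normalized (g m : E) (hm : m ≠ 0) :
    ‖g‖ - 2 * ‖g - m‖ ≤ ⟪g, (‖m‖)⁻¹ • m⟫ := by
  have hm' : ‖m‖ ≠ 0 := norm_ne_zero_iff.2 hm
  have hu : ‖(‖m‖)⁻¹ • m‖ = 1 := by
    rw [norm_smul, norm_inv, norm_norm, inv_mul_cancel₀ hm']
  have h1 : ⟪m, (‖m‖)⁻¹ • m⟫ = ‖m‖ := by
    rw [real_inner_smul_right, real_inner_self_eq_norm_sq]
    field_simp
  have h2 := neg_le_of_abs_le (abs_real_inner_le_norm (g - m) ((‖m‖)⁻¹ • m))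
  rw [hu, inner_sub_left, h1] at h2
  have h3 := norm_sub_norm_le g m
  linarith

/-- A point whose slope for `√(M - f)` is below the PL threshold is a maximizer. -/
theorem exists_eq_max_of_pl [FiniteDimensional ℝ E] {f : E → ℝ} {g : E → E} {M ν c : ℝ}
    (hf : ∀ z, HasFDerivAt f (innerSL ℝ (g z)) z) (hM : ∀ z, f z ≤ M)
    (hPL : ∀ z, 2 * ν * (M - f z) ≤ ‖g z‖ ^ 2) (hc : 0 < c) (hcν : 2 * c ^ 2 < ν) (y : E) :
    ∃ z, f z = M ∧ c * ‖z - y‖ ≤ √(M - f y) := by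
  have hfc : Continuous f :=
    continuous_iff_continuousAt.2 fun z => (hf z).continuousAt
  obtain ⟨z, hz⟩ : ∃ z, ∀ w, √(M - f z) + c * ‖z - y‖ ≤ √(M - f w) + c * ‖w - y‖ := by
    refine Continuous.exists_forall_le (f := fun w => √(M - f w) + c * ‖w - y‖)
      (by fun_prop) ?_
    refine Filter.tendsto_atTop_mono (f := fun w => c * (‖w‖ - ‖y‖)) (fun w => ?_) ?_
    · have := norm_sub_norm_le w y
      nlinarith [Real.sqrt_nonneg (M - f w)]
    · refine Filter.Tendsto.const_mul_atTop hc ?_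
      exact Filter.tendsto_atTop_add_const_right _ _ (tendsto_norm_cocompact_atTop (E := E))
  have hzy : c * ‖z - y‖ ≤ √(M - f y) := by
    have := hz y
    rw [sub_self, norm_zero] at this
    linarith [Real.sqrt_nonneg (M - f z)]
  refine ⟨z, ?_, hzy⟩
  by_contra hne
  have hpos : 0 < M - f z := sub_pos.2 (lt_of_le_of_ne (hM z) hne)
  have hs : 0 < √(M - f z) := Real.sqrt_pos.2 hpos
  have hss : √(M - f z) ^ 2 = M - f z := Real.sq_sqrt hpos.le
  have hline : HasDerivAt (fun t : ℝ => z + t • g z) (g z) 0 := by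
    simpa using ((hasDerivAt_id (0 : ℝ)).smul_const (g z)).const_add z
  have hd : HasDerivAt (fun t : ℝ => √(M - f (z + t • g z)))
      (-(‖g z‖ ^ 2) / (2 * √(M - f z))) 0 := by
    have h0 : HasFDerivAt f (innerSL ℝ (g z)) (z + (0 : ℝ) • g z) := by simpa using hf z
    have h1 := ((h0.comp_hasDerivAt (0 : ℝ) hline).const_sub M).sqrt (by simpa using hpos.ne')
    simpa [real_inner_self_eq_norm_sq] using h1
  have hlim := hd.tendsto_slope_zero_right
  have hge : -(c * ‖g z‖) ≤ -(‖g z‖ ^ 2) / (2 * √(M - f z)) := by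
    refine ge_of_tendsto hlim ?_
    filter_upwards [self_mem_nhdsWithin] with t ht
    have ht' : (0 : ℝ) < t := ht
    have h1 := hz (z + t • g z)
    have h2 : ‖z + t • g z - y‖ ≤ ‖z - y‖ + t * ‖g z‖ := by
      have := norm_add_le (z - y) (t • g z)
      rw [norm_smul, Real.norm_of_nonneg ht'.le] at this
      rwa [add_sub_right_comm]
    simp only [zero_add, zero_smul, add_zero, smul_eq_mul]
    rw [inv_mul_eq_div, le_div_iff₀ ht']
    nlinarith
  rw [le_div_iff₀ (by positivity)] at hge
  have hp := hPL z
  have hν : 0 < ν := by nlinarith [sq_nonneg c]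
  have hgpos : 0 < ‖g z‖ := by
    have : 0 < ‖g z‖ ^ 2 := lt_of_lt_of_le (by positivity) hp
    exact lt_of_le_of_ne (norm_nonneg _) fun h => by simp [← h] at this
  have h4 : ‖g z‖ ≤ 2 * c * √(M - f z) := by
    refine le_of_mul_le_mul_left ?_ hgpos
    nlinarith
  have h5 : ‖g z‖ ^ 2 ≤ (2 * c * √(M - f z)) ^ 2 := pow_le_pow_left₀ hgpos.le h4 2
  rw [mul_pow, hss] at h5
  nlinarith

theorem infDist_sq_le_of_pl [FiniteDimensional ℝ E] {f : E → ℝ} {g : E → E} {M ν : ℝ}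
    (hν : 0 < ν) (hf : ∀ z, HasFDerivAt f (innerSL ℝ (g z)) z) (hM : ∀ z, f z ≤ M)
    (hPL : ∀ z, 2 * ν * (M - f z) ≤ ‖g z‖ ^ 2) (y : E) :
    ν / 2 * Metric.infDist y {z | f z = M} ^ 2 ≤ M - f y := by
  have key : ∀ c : ℝ, 0 < c → 2 * c ^ 2 < ν →
      c ^ 2 * Metric.infDist y {z | f z = M} ^ 2 ≤ M - f y := by
    intro c hc hcν
    obtain ⟨z, hz, hzy⟩ := exists_eq_max_of_pl hf hM hPL hc hcν y
    have h1 : Metric.infDist y {z | f z = M} ≤ ‖z - y‖ := by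
      rw [← dist_eq_norm, dist_comm]
      exact Metric.infDist_le_dist_of_mem hz
    have h2 : c * Metric.infDist y {z | f z = M} ≤ √(M - f y) :=
      (mul_le_mul_of_nonneg_left h1 hc.le).trans hzy
    have h3 := pow_le_pow_left₀ (mul_nonneg hc.le Metric.infDist_nonneg) h2 2
    rwa [mul_pow, Real.sq_sqrt (sub_nonneg.2 (hM y))] at h3
  by_contra! hlt
  set D := Metric.infDist y {z | f z = M} ^ 2
  have hD : 0 ≤ D := sq_nonneg _
  have hpos : 0 ≤ M - f y := sub_nonneg.2 (hM y)
  have hDpos : 0 < D := by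
    by_contra! h
    nlinarith
  obtain ⟨a, ha1, ha2⟩ := exists_between ((div_lt_iff₀ hDpos).2 hlt)
  have ha : 0 < a := lt_of_le_of_lt (by positivity) ha1
  have := key (√a) (Real.sqrt_pos.2 ha) (by rw [Real.sq_sqrt ha.le]; linarith)
  rw [Real.sq_sqrt ha.le] at this
  rw [div_lt_iff₀ hDpos] at ha1
  linarith

end PolyakLojasiewicz

theorem Penv_eq_of_mem_argmaxY {α β : Type*} {J : α → β → ℝ} {x : α} {y : β}
    (hy : y ∈ argmaxY J x) : Penv J x = J x y :=
  le_antisymm (haveI : Nonempty β := ⟨y⟩; ciSup_le hy)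
    (le_ciSup (f := J x) ⟨J x y, by rintro _ ⟨w, rfl⟩; exact hy w⟩ y)

theorem argmaxY_eq_setOf_eq_Penv {α β : Type*} {J : α → β → ℝ} {x : α}
    (h : ∃ y, y ∈ argmaxY J x) : argmaxY J x = {y | J x y = Penv J x} := by
  obtain ⟨y₀, hy₀⟩ := h
  ext y
  refine ⟨fun hy => (Penv_eq_of_mem_argmaxY hy).symm, fun hy w => ?_⟩
  rw [Set.mem_ofPred_eq, Penv_eq_of_mem_argmaxY hy₀] at hy
  exact (hy₀ w).trans_eq hy.symm

/-- Summation of the one-step recursion for the value gap `δ` and the distance `d`. -/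
theorem sum_le_of_gap_recursion {a b ν K : ℝ} {d δ e : ℕ → ℝ} (hν : 0 < ν)
    (hδ : ∀ i, ν / 2 * d i ^ 2 ≤ δ i) (hb : 0 ≤ b) (hd : ∀ i, 0 ≤ d i)
    (hrec : ∀ i, a * d i ≤ δ i - δ (i + 1) + b * d (i + 1) + e i + K) (T : ℕ) :
    (a - b) * ∑ i ∈ Finset.range T, d i ≤
      δ 0 + b ^ 2 / (2 * ν) + ∑ i ∈ Finset.range T, e i + T * K := by
  have h : ∀ T : ℕ, (a - b) * ∑ i ∈ Finset.range T, d i ≤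
      δ 0 - δ T + b * d T + ∑ i ∈ Finset.range T, e i + T * K := by
    intro T
    induction T with
    | zero => simpa using mul_nonneg hb (hd 0)
    | succ n ih =>
      rw [Finset.sum_range_succ, Finset.sum_range_succ]
      push_cast
      have := hrec n
      linarith
  have h1 : b * d T - ν / 2 * d T ^ 2 ≤ b ^ 2 / (2 * ν) := by
    rw [le_div_iff₀ (by positivity)]
    nlinarith [sq_nonneg (b - ν * d T)]
  linarith [h T, hδ T]

theorem average_le_of_gap_bound {Lf ν μx μy S R Δ d₀ T : ℝ} (hLf : 0 < Lf) (hν : 0 < ν)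
    (hμx : 0 < μx) (hμy : 0 < μy) (hstep : μx ≤ μy / (6 * (Lf / ν))) (hT : 1 ≤ T)
    (hS : 0 ≤ S) (hR : 0 ≤ R) (hΔ : 0 ≤ Δ) (hd0 : 0 ≤ d₀)
    (hsum : (ν * μy - Lf * μx) * S ≤
      Δ + (Lf * μx) ^ 2 / (2 * ν) + 2 * μy * R + T * (Lf / 2 * μy ^ 2)) :
    1 / T * S ≤ 2 * d₀ / T + 6 * Δ / (ν * μy * T) + 16 / (ν * T) * R
      + (3 * (Lf / ν) * μy + μx / 2 + 17 * (Lf / ν) * μx + 2 * μy) := by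
  have hstep' : 6 * (Lf * μx) ≤ ν * μy := by
    rw [le_div_iff₀ (by positivity)] at hstep
    have h := mul_le_mul_of_nonneg_left hstep hν.le
    have : ν * (μx * (6 * (Lf / ν))) = 6 * (Lf * μx) := by field_simp
    linarith
  have hTpos : 0 < T := by linarith
  have hquad : (Lf * μx) ^ 2 / (2 * ν) ≤ T * (Lf * μx * μy) := by
    rw [div_le_iff₀ (by positivity)]
    have h1 : Lf * μx * (6 * (Lf * μx)) ≤ Lf * μx * (ν * μy) :=
      mul_le_mul_of_nonneg_left hstep' (by positivity)
    have h2 : 0 ≤ (T - 1) * (Lf * μx * μy * ν) :=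
      mul_nonneg (by linarith) (by positivity)
    have h3 : 0 < Lf * μx * μy * ν := by positivity
    nlinarith
  have hmain : ν * μy * S ≤ 2 * (Δ + T * (Lf * μx * μy) + 2 * μy * R + T * (Lf / 2 * μy ^ 2)) := by
    have h1 := mul_le_mul_of_nonneg_right hstep' hS
    have h2 : 0 ≤ ν * μy * S := by positivity
    rw [sub_mul] at hsum
    linarith
  have hfin : S ≤ 2 * d₀ + 6 * Δ / (ν * μy) + 16 / ν * R
      + T * (3 * (Lf / ν) * μy + μx / 2 + 17 * (Lf / ν) * μx + 2 * μy) := by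
    refine le_of_mul_le_mul_left (hmain.trans ?_) (by positivity : 0 < ν * μy)
    have : ν * μy * (2 * d₀ + 6 * Δ / (ν * μy) + 16 / ν * R
        + T * (3 * (Lf / ν) * μy + μx / 2 + 17 * (Lf / ν) * μx + 2 * μy)) =
        2 * (ν * μy * d₀) + 6 * Δ + 16 * μy * R
        + (3 * (T * (Lf * μy ^ 2)) + ν * μy * T * (μx / 2) + 17 * (T * (Lf * μx * μy))
          + 2 * (ν * μy * T * μy)) := by
      field_simp
    rw [this]
    have p1 : 0 ≤ ν * μy * d₀ := by positivity
    have p2 : 0 ≤ μy * R := by positivity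
    have p3 : 0 ≤ T * (Lf * μy ^ 2) := by positivity
    have p4 : 0 ≤ ν * μy * T * (μx / 2) := by positivity
    have p5 : 0 ≤ T * (Lf * μx * μy) := by positivity
    have p6 : 0 ≤ ν * μy * T * μy := by positivity
    linarith
  refine (mul_le_mul_of_nonneg_left hfin (by positivity : 0 ≤ 1 / T)).trans_eq ?_
  field_simp

/-- Averaged optimality-gap bound for Fed-MiMA-type normalized server
iterates `x_{i+1} = x_i − μ_x m^x_i/‖m^x_i‖`, `y_{i+1} = y_i + μ_y m^y_i/‖m^y_i‖` under `L_f`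
smoothness, the `ν`-PL condition with attained supremum, and `μ_x ≤ μ_y/(6κ)`, `κ = L_f/ν`. -/
theorem fedmima_optimality_gap_bound
    (M₁ M₂ : ℕ) (hM₁ : 0 < M₁) (hM₂ : 0 < M₂)
    (Lf ν μx μy : ℝ) (hLf : 0 < Lf) (hν : 0 < ν) (hμx : 0 < μx) (hμy : 0 < μy)
    (J : EuclideanSpace ℝ (Fin M₁) → EuclideanSpace ℝ (Fin M₂) → ℝ)
    (gx : EuclideanSpace ℝ (Fin M₁) → EuclideanSpace ℝ (Fin M₂) → EuclideanSpace ℝ (Fin M₁))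
    (gy : EuclideanSpace ℝ (Fin M₁) → EuclideanSpace ℝ (Fin M₂) → EuclideanSpace ℝ (Fin M₂))
    (hJdiff : ∀ x y,
      HasGradientAt
        (fun z : WithLp 2 (EuclideanSpace ℝ (Fin M₁) × EuclideanSpace ℝ (Fin M₂)) =>
          J (WithLp.equiv 2 _ z).1 (WithLp.equiv 2 _ z).2)
        ((WithLp.equiv 2 _).symm (gx x y, gy x y)) ((WithLp.equiv 2 _).symm (x, y)))
    (hJlip : ∀ x₁ y₁ x₂ y₂,
      ‖gx x₁ y₁ - gx x₂ y₂‖ ^ 2 + ‖gy x₁ y₁ - gy x₂ y₂‖ ^ 2 ≤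
        Lf ^ 2 * (‖x₁ - x₂‖ ^ 2 + ‖y₁ - y₂‖ ^ 2))
    (hattain : ∀ x, ∃ y, ∀ y', J x y' ≤ J x y)
    (hPL : ∀ x y, 2 * ν * (Penv J x - J x y) ≤ ‖gy x y‖ ^ 2)
    (x : ℕ → EuclideanSpace ℝ (Fin M₁)) (y : ℕ → EuclideanSpace ℝ (Fin M₂))
    (mx : ℕ → EuclideanSpace ℝ (Fin M₁)) (my : ℕ → EuclideanSpace ℝ (Fin M₂))
    (hmx : ∀ i, mx i ≠ 0) (hmy : ∀ i, my i ≠ 0)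
    (hxupd : ∀ i, x (i + 1) = x i - (μx / ‖mx i‖) • mx i)
    (hyupd : ∀ i, y (i + 1) = y i + (μy / ‖my i‖) • my i)
    (hstep : μx ≤ μy / (6 * (Lf / ν)))
    (T : ℕ) (hT : 1 ≤ T) :
    (1 / (T : ℝ)) * ∑ i ∈ Finset.range T, Metric.infDist (y i) (argmaxY J (x i)) ≤
      2 * Metric.infDist (y 0) (argmaxY J (x 0)) / T
      + 6 * (Penv J (x 0) - J (x 0) (y 0)) / (ν * μy * T)
      + (16 / (ν * T)) * ∑ i ∈ Finset.range T, ‖gy (x i) (y i) - my i‖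
      + (3 * (Lf / ν) * μy + μx / 2 + 17 * (Lf / ν) * μx + 2 * μy) := by
  have hfull := fun u v => (hJdiff u v).hasFDerivAt
  have hdx : ∀ v u, HasFDerivAt (fun u => J u v) (innerSL ℝ (gx u v)) u := by
    intro v u
    have h1 := ((WithLp.prodContinuousLinearEquiv 2 ℝ (EuclideanSpace ℝ (Fin M₁))
      (EuclideanSpace ℝ (Fin M₂))).symm.hasFDerivAt (x := (u, v))).comp u
      (hasFDerivAt_prodMk_left (𝕜 := ℝ) u v)
    refine ((hfull u v).comp u h1).congr_fderiv ?_
    ext w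
    simp [WithLp.prod_inner_apply]
  have hdy : ∀ u v, HasFDerivAt (J u) (innerSL ℝ (gy u v)) v := by
    intro u v
    have h1 := ((WithLp.prodContinuousLinearEquiv 2 ℝ (EuclideanSpace ℝ (Fin M₁))
      (EuclideanSpace ℝ (Fin M₂))).symm.hasFDerivAt (x := (u, v))).comp v
      (hasFDerivAt_prodMk_right (𝕜 := ℝ) u v)
    refine ((hfull u v).comp v h1).congr_fderiv ?_
    ext w
    simp [WithLp.prod_inner_apply]
  have hlipx : ∀ u v w, ‖gx u v - gx u w‖ ≤ Lf * ‖v - w‖ := by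
    intro u v w
    refine le_of_sq_le_sq ?_ (by positivity)
    have := hJlip u v u w
    rw [sub_self, norm_zero] at this
    nlinarith [sq_nonneg ‖gy u v - gy u w‖]
  have hlipy : ∀ u v w, ‖gy u v - gy u w‖ ≤ Lf * ‖v - w‖ := by
    intro u v w
    refine le_of_sq_le_sq ?_ (by positivity)
    have := hJlip u v u w
    rw [sub_self, norm_zero] at this
    nlinarith [sq_nonneg ‖gx u v - gx u w‖]
  have hle : ∀ u v, J u v ≤ Penv J u := by
    intro u v
    obtain ⟨w, hw⟩ := hattain u
    rw [Penv_eq_of_mem_argmaxY hw]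
    exact hw v
  have hset : ∀ u, argmaxY J u = {v | J u v = Penv J u} := fun u =>
    argmaxY_eq_setOf_eq_Penv (hattain u)
  have hcont : ∀ u, Continuous (J u) := fun u =>
    continuous_iff_continuousAt.2 fun v => (hdy u v).continuousAt
  have hQG : ∀ u v, ν / 2 * Metric.infDist v (argmaxY J u) ^ 2 ≤ Penv J u - J u v := by
    intro u v
    rw [hset]
    exact infDist_sq_le_of_pl hν (hdy u) (hle u) (hPL u) v
  have hEB : ∀ u v, ν * Metric.infDist v (argmaxY J u) ≤ ‖gy u v‖ := by
    intro u v
    refine le_of_sq_le_sq ?_ (norm_nonneg _)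
    nlinarith [hQG u v, hPL u v]
  have hcross : ∀ u u' v, Penv J u' - J u' v ≤
      Penv J u - J u v + Lf * ‖u' - u‖ * Metric.infDist v (argmaxY J u') := by
    intro u u' v
    have hcl : IsClosed (argmaxY J u') := by
      rw [hset]
      exact isClosed_eq (hcont u') continuous_const
    obtain ⟨w, hw, hwd⟩ := hcl.exists_infDist_eq_dist (hattain u') v
    have h1 := Convex.norm_image_sub_le_of_norm_hasFDerivWithin_le
      (f := fun s => J s w - J s v) (s := Set.univ) (C := Lf * ‖w - v‖) (x := u) (y := u')
      (fun s _ => ((hdx w s).sub (hdx v s)).hasFDerivWithinAt)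
      (fun s _ => by
        rw [← map_sub, innerSL_apply_norm]
        exact hlipx s w v)
      convex_univ (Set.mem_univ _) (Set.mem_univ _)
    have h2 := (le_abs_self _).trans h1
    rw [hwd, dist_comm, dist_eq_norm, Penv_eq_of_mem_argmaxY hw]
    nlinarith [hle u w]
  have hxs : ∀ i, ‖x (i + 1) - x i‖ = μx := by
    intro i
    rw [hxupd, sub_sub_cancel_left, norm_neg, norm_smul, norm_div, norm_norm,
      Real.norm_of_nonneg hμx.le, div_mul_cancel₀ _ (norm_ne_zero_iff.2 (hmx i))]
  have hasc : ∀ i, μy * ‖gy (x i) (y i)‖ ≤ J (x i) (y (i + 1)) - J (x i) (y i)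
      + 2 * μy * ‖gy (x i) (y i) - my i‖ + Lf / 2 * μy ^ 2 := by
    intro i
    have h1 := descent_lower_bound (hdy (x i)) (hlipy (x i)) (y i) ((μy / ‖my i‖) • my i)
    have h2 := norm_sub_two_mul_le_inner_normalized (gy (x i) (y i)) (my i) (hmy i)
    have h3 : ‖(μy / ‖my i‖) • my i‖ = μy := by
      rw [norm_smul, norm_div, norm_norm, Real.norm_of_nonneg hμy.le,
        div_mul_cancel₀ _ (norm_ne_zero_iff.2 (hmy i))]
    rw [← hyupd, h3, div_eq_mul_inv, mul_smul, real_inner_smul_right] at h1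
    nlinarith
  have hsum := sum_le_of_gap_recursion (a := ν * μy) (b := Lf * μx) (ν := ν)
    (K := Lf / 2 * μy ^ 2) (d := fun i => Metric.infDist (y i) (argmaxY J (x i)))
    (δ := fun i => Penv J (x i) - J (x i) (y i))
    (e := fun i => 2 * μy * ‖gy (x i) (y i) - my i‖) hν (fun i => hQG _ _) (by positivity)
    (fun i => Metric.infDist_nonneg) (fun i => by
      have h1 := hasc i
      have h2 := hcross (x i) (x (i + 1)) (y (i + 1))
      have h3 := mul_le_mul_of_nonneg_left (hEB (x i) (y i)) hμy.le
      rw [hxs] at h2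
      linarith) T
  rw [← Finset.mul_sum] at hsum
  exact average_le_of_gap_bound hLf hν hμx hμy hstep (by exact_mod_cast hT)
    (Finset.sum_nonneg fun i _ => Metric.infDist_nonneg)
    (Finset.sum_nonneg fun i _ => norm_nonneg _) (sub_nonneg.2 (hle _ _))
    Metric.infDist_nonneg hsum
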